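/- arXiv:1906.11377 — 2 statements merged into one kernel-verified Lean document; each statement's English description precedes it below -/
import Mathlib

section
/- The injective tensor product of convex bodies respects sections: Let P_i ⊆ E_i (i = 1,…,l) be convex bodies containing 0 in their interiors in finite-dimensional real inner product spaces, and let M_i ⊆ E_i be linear subspaces equipped with the induced inner products. Then (P_1∩M_1)⊗_ε⋯⊗_ε(P_l∩M_l) = (P_1⊗_ε⋯⊗_εP_l) ∩ ⊗_{i=1}^l M_i, where the left-hand side is computed inside ⊗_{i=1}^l M_i. -/
open scoped TensorProduct RealInnerProductSpace Pointwise
open PiTensorProduct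

noncomputable section

variable {l : ℕ}

/-- The Hilbert tensor inner product on `⨂[ℝ] i, E i`, determined on decomposable
tensors by `⟪⨂ₜ x i, ⨂ₜ y i⟫_H = ∏ i, ⟪x i, y i⟫`. -/
def tensorInner (E : Fin l → Type) [∀ i, NormedAddCommGroup (E i)]
    [∀ i, InnerProductSpace ℝ (E i)] :
    (⨂[ℝ] i, E i) →ₗ[ℝ] (⨂[ℝ] i, E i) →ₗ[ℝ] ℝ :=
  (PiTensorProduct.map₂ (fun i => innerₗ (E i))).compr₂
    (PiTensorProduct.lift (MultilinearMap.mkPiAlgebra ℝ (Fin l) ℝ))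

/-- The polar of a set with respect to a bilinear pairing `B`:
`C° = {z | ∀ u ∈ C, B u z ≤ 1}`. -/
def polarB {V : Type*} [AddCommGroup V] [Module ℝ V]
    (B : V →ₗ[ℝ] V →ₗ[ℝ] ℝ) (C : Set V) : Set V :=
  {z | ∀ u ∈ C, B u z ≤ 1}

/-- The projective tensor product of sets:
`P₁ ⊗_π ⋯ ⊗_π P_l = conv {x¹ ⊗ ⋯ ⊗ x^l : xⁱ ∈ P i}`. -/
def projTP (E : Fin l → Type) [∀ i, NormedAddCommGroup (E i)]
    [∀ i, InnerProductSpace ℝ (E i)] (P : ∀ i, Set (E i)) : Set (⨂[ℝ] i, E i) :=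
  convexHull ℝ {u | ∃ x : ∀ i, E i, (∀ i, x i ∈ P i) ∧ u = ⨂ₜ[ℝ] i, x i}

/-- The injective tensor product of sets:
`P₁ ⊗_ε ⋯ ⊗_ε P_l = (P₁° ⊗_π ⋯ ⊗_π P_l°)°`, polars taken with respect to the
Hilbert tensor inner product. -/
def injTP (E : Fin l → Type) [∀ i, NormedAddCommGroup (E i)]
    [∀ i, InnerProductSpace ℝ (E i)] (P : ∀ i, Set (E i)) : Set (⨂[ℝ] i, E i) :=
  polarB (tensorInner E) (projTP E (fun i => polarB (innerₗ (E i)) (P i)))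

/-- The canonical topology on the (finite-dimensional) tensor product space, defined
instance-free as the weak topology induced by all linear functionals; for
finite-dimensional real vector spaces this is the canonical (Euclidean) topology. -/
instance tensorTopology (E : Fin l → Type) [∀ i, NormedAddCommGroup (E i)]
    [∀ i, InnerProductSpace ℝ (E i)] : TopologicalSpace (⨂[ℝ] i, E i) :=
  ⨅ (f : (⨂[ℝ] i, E i) →ₗ[ℝ] ℝ), TopologicalSpace.induced f inferInstance

/-- A convex body: a compact convex set with nonempty interior. -/
def IsConvexBody {V : Type*} [AddCommGroup V] [Module ℝ V] [TopologicalSpace V]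
    (P : Set V) : Prop :=
  IsCompact P ∧ Convex ℝ P ∧ (interior P).Nonempty

/-- A convex body containing `0` in its interior. -/
def IsZeroBody {V : Type*} [AddCommGroup V] [Module ℝ V] [TopologicalSpace V]
    (P : Set V) : Prop :=
  IsCompact P ∧ Convex ℝ P ∧ 0 ∈ interior P

/-- A `0`-symmetric convex body. -/
def IsSymBody {V : Type*} [AddCommGroup V] [Module ℝ V] [TopologicalSpace V]
    (P : Set V) : Prop :=
  IsConvexBody P ∧ P = -P

/-- An assignment, to every `l`-tuple of finite-dimensional real inner product spaces
and every `l`-tuple of subsets thereof, of a subset of the tensor product space. -/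
abbrev TPAssignment (l : ℕ) : Type 1 :=
  ∀ (E : Fin l → Type) [∀ i, NormedAddCommGroup (E i)] [∀ i, InnerProductSpace ℝ (E i)]
    [∀ i, FiniteDimensional ℝ (E i)], (∀ i, Set (E i)) → Set (⨂[ℝ] i, E i)

/-- A tensor product of (order `l` of) convex bodies with zero in the interior:
on every tuple of convex bodies with `0` in the interior its value is a convex body
sandwiched between the projective and the injective tensor products, and it has the
uniform property. -/
def IsTPB (A : TPAssignment l) : Prop :=
  (∀ (E : Fin l → Type) [∀ i, NormedAddCommGroup (E i)] [∀ i, InnerProductSpace ℝ (E i)]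
      [∀ i, FiniteDimensional ℝ (E i)] (P : ∀ i, Set (E i)), (∀ i, IsZeroBody (P i)) →
      IsConvexBody (A E P) ∧ projTP E P ⊆ A E P ∧ A E P ⊆ injTP E P) ∧
  (∀ (E F : Fin l → Type) [∀ i, NormedAddCommGroup (E i)] [∀ i, InnerProductSpace ℝ (E i)]
      [∀ i, FiniteDimensional ℝ (E i)] [∀ i, NormedAddCommGroup (F i)]
      [∀ i, InnerProductSpace ℝ (F i)] [∀ i, FiniteDimensional ℝ (F i)]
      (P : ∀ i, Set (E i)) (Q : ∀ i, Set (F i)) (T : ∀ i, E i →ₗ[ℝ] F i),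
      (∀ i, IsZeroBody (P i)) → (∀ i, IsZeroBody (Q i)) → (∀ i, T i '' P i ⊆ Q i) →
      PiTensorProduct.map T '' A E P ⊆ A F Q)

/-- A tensor product of (order `l` of) `0`-symmetric convex bodies. -/
def IsTPSym (A : TPAssignment l) : Prop :=
  (∀ (E : Fin l → Type) [∀ i, NormedAddCommGroup (E i)] [∀ i, InnerProductSpace ℝ (E i)]
      [∀ i, FiniteDimensional ℝ (E i)] (P : ∀ i, Set (E i)), (∀ i, IsSymBody (P i)) →
      IsSymBody (A E P) ∧ projTP E P ⊆ A E P ∧ A E P ⊆ injTP E P) ∧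
  (∀ (E F : Fin l → Type) [∀ i, NormedAddCommGroup (E i)] [∀ i, InnerProductSpace ℝ (E i)]
      [∀ i, FiniteDimensional ℝ (E i)] [∀ i, NormedAddCommGroup (F i)]
      [∀ i, InnerProductSpace ℝ (F i)] [∀ i, FiniteDimensional ℝ (F i)]
      (P : ∀ i, Set (E i)) (Q : ∀ i, Set (F i)) (T : ∀ i, E i →ₗ[ℝ] F i),
      (∀ i, IsSymBody (P i)) → (∀ i, IsSymBody (Q i)) → (∀ i, T i '' P i ⊆ Q i) →
      PiTensorProduct.map T '' A E P ⊆ A F Q)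

/-- The dual of an assignment: `P₁ ⊗_{α'} ⋯ ⊗_{α'} P_l = (P₁° ⊗_α ⋯ ⊗_α P_l°)°`. -/
def dualTP (A : TPAssignment l) : TPAssignment l :=
  fun E _ _ _ P =>
    polarB (tensorInner E) (A E (fun i => polarB (innerₗ (E i)) (P i)))

/-- The order on tensor products of convex bodies with zero in the interior. -/
def leTPB (A B : TPAssignment l) : Prop :=
  ∀ (E : Fin l → Type) [∀ i, NormedAddCommGroup (E i)] [∀ i, InnerProductSpace ℝ (E i)]
    [∀ i, FiniteDimensional ℝ (E i)] (P : ∀ i, Set (E i)), (∀ i, IsZeroBody (P i)) →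
    A E P ⊆ B E P

/-- The order on tensor products of `0`-symmetric convex bodies. -/
def leTPSym (A B : TPAssignment l) : Prop :=
  ∀ (E : Fin l → Type) [∀ i, NormedAddCommGroup (E i)] [∀ i, InnerProductSpace ℝ (E i)]
    [∀ i, FiniteDimensional ℝ (E i)] (P : ∀ i, Set (E i)), (∀ i, IsSymBody (P i)) →
    A E P ⊆ B E P

/-- Injectivity of a tensor product of convex bodies: it respects sections by subspaces. -/
def IsInjectiveTPB (A : TPAssignment l) : Prop :=
  ∀ (E : Fin l → Type) [∀ i, NormedAddCommGroup (E i)] [∀ i, InnerProductSpace ℝ (E i)]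
    [∀ i, FiniteDimensional ℝ (E i)] (P : ∀ i, Set (E i)) (M : ∀ i, Submodule ℝ (E i)),
    (∀ i, IsZeroBody (P i)) →
    PiTensorProduct.map (fun i => (M i).subtype) ''
        A (fun i => ↥(M i)) (fun i => Subtype.val ⁻¹' P i)
      = A E P ∩ Set.range (PiTensorProduct.map (fun i => (M i).subtype))

/-- Projectivity of a tensor product of convex bodies: it respects quotients. -/
def IsProjectiveTPB (A : TPAssignment l) : Prop :=
  ∀ (E F : Fin l → Type) [∀ i, NormedAddCommGroup (E i)] [∀ i, InnerProductSpace ℝ (E i)]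
    [∀ i, FiniteDimensional ℝ (E i)] [∀ i, NormedAddCommGroup (F i)]
    [∀ i, InnerProductSpace ℝ (F i)] [∀ i, FiniteDimensional ℝ (F i)]
    (P : ∀ i, Set (E i)) (T : ∀ i, E i →ₗ[ℝ] F i),
    (∀ i, IsZeroBody (P i)) → (∀ i, Function.Surjective (T i)) →
    PiTensorProduct.map T '' A E P = A F (fun i => T i '' P i)

/-- Injectivity of a tensor product of `0`-symmetric convex bodies. -/
def IsInjectiveSym (A : TPAssignment l) : Prop :=
  ∀ (E : Fin l → Type) [∀ i, NormedAddCommGroup (E i)] [∀ i, InnerProductSpace ℝ (E i)]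
    [∀ i, FiniteDimensional ℝ (E i)] (P : ∀ i, Set (E i)) (M : ∀ i, Submodule ℝ (E i)),
    (∀ i, IsSymBody (P i)) →
    PiTensorProduct.map (fun i => (M i).subtype) ''
        A (fun i => ↥(M i)) (fun i => Subtype.val ⁻¹' P i)
      = A E P ∩ Set.range (PiTensorProduct.map (fun i => (M i).subtype))

/-- Projectivity of a tensor product of `0`-symmetric convex bodies. -/
def IsProjectiveSym (A : TPAssignment l) : Prop :=
  ∀ (E F : Fin l → Type) [∀ i, NormedAddCommGroup (E i)] [∀ i, InnerProductSpace ℝ (E i)]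
    [∀ i, FiniteDimensional ℝ (E i)] [∀ i, NormedAddCommGroup (F i)]
    [∀ i, InnerProductSpace ℝ (F i)] [∀ i, FiniteDimensional ℝ (F i)]
    (P : ∀ i, Set (E i)) (T : ∀ i, E i →ₗ[ℝ] F i),
    (∀ i, IsSymBody (P i)) → (∀ i, Function.Surjective (T i)) →
    PiTensorProduct.map T '' A E P = A F (fun i => T i '' P i)

/-- The intersection of all injective tensor products of convex bodies above `A`. -/
def injHullB (A : TPAssignment l) : TPAssignment l :=
  fun E _ _ _ P =>
    ⋂ B ∈ {B : TPAssignment l | IsTPB B ∧ IsInjectiveTPB B ∧ leTPB A B}, B E P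

/-- The intersection of all injective tensor products of `0`-symmetric convex bodies
above `A`. -/
def injHullSym (A : TPAssignment l) : TPAssignment l :=
  fun E _ _ _ P =>
    ⋂ B ∈ {B : TPAssignment l | IsTPSym B ∧ IsInjectiveSym B ∧ leTPSym A B}, B E P

/-- The projective hull `⊗_{α^{proj}} = ⊗_{((α')^{inj})'}` (convex bodies version). -/
def projHullB (A : TPAssignment l) : TPAssignment l :=
  dualTP (injHullB (dualTP A))

/-- The projective hull `⊗_{α^{proj}} = ⊗_{((α')^{inj})'}` (`0`-symmetric version). -/
def projHullSym (A : TPAssignment l) : TPAssignment l :=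
  dualTP (injHullSym (dualTP A))

/-- The Banach–Mazur distance between `0`-symmetric convex bodies:
`inf {λ ≥ 1 : ∃ bijective linear T, Q ⊆ T(P) ⊆ λQ}`. -/
def deltaBM {V : Type*} [AddCommGroup V] [Module ℝ V] (P Q : Set V) : ℝ :=
  sInf {lam : ℝ | 1 ≤ lam ∧ ∃ T : V ≃ₗ[ℝ] V, Q ⊆ T '' P ∧ T '' P ⊆ lam • Q}

/-- The projective tensor norm `π` on the tensor product of normed spaces. -/
def projNorm (M : Fin l → Type) [∀ i, NormedAddCommGroup (M i)] [∀ i, NormedSpace ℝ (M i)]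
    (u : ⨂[ℝ] i, M i) : ℝ :=
  sInf {r | ∃ (n : ℕ) (x : Fin n → ∀ i, M i),
    u = (∑ j, ⨂ₜ[ℝ] i, x j i) ∧ r = ∑ j, ∏ i, ‖x j i‖}

/-- The injective tensor norm `ε` on the tensor product of normed spaces:
`ε(u) = sup {|x₁* ⊗ ⋯ ⊗ x_l* (u)| : ‖x_i*‖ ≤ 1}`. -/
def injNorm (M : Fin l → Type) [∀ i, NormedAddCommGroup (M i)] [∀ i, NormedSpace ℝ (M i)]
    (u : ⨂[ℝ] i, M i) : ℝ :=
  sSup {r | ∃ f : ∀ i, M i →L[ℝ] ℝ, (∀ i, ‖f i‖ ≤ 1) ∧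
    r = |PiTensorProduct.lift ((MultilinearMap.mkPiAlgebra ℝ (Fin l) ℝ).compLinearMap
        (fun i => (f i : M i →ₗ[ℝ] ℝ))) u|}

/-- An assignment of a real-valued function on the tensor product of every `l`-tuple of
finite-dimensional Banach spaces. -/
abbrev TNAssignment (l : ℕ) : Type 1 :=
  ∀ (M : Fin l → Type) [∀ i, NormedAddCommGroup (M i)] [∀ i, NormedSpace ℝ (M i)]
    [∀ i, FiniteDimensional ℝ (M i)], (⨂[ℝ] i, M i) → ℝ

/-- A tensor norm of order `l` on the class of finite-dimensional Banach spaces: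
on each tuple it is a norm which is a reasonable crossnorm (`ε ≤ α ≤ π`), and it
satisfies the uniform property. -/
def IsTensorNormFD (ν : TNAssignment l) : Prop :=
  (∀ (M : Fin l → Type) [∀ i, NormedAddCommGroup (M i)] [∀ i, NormedSpace ℝ (M i)]
      [∀ i, FiniteDimensional ℝ (M i)] (u v : ⨂[ℝ] i, M i),
      ν M (u + v) ≤ ν M u + ν M v) ∧
  (∀ (M : Fin l → Type) [∀ i, NormedAddCommGroup (M i)] [∀ i, NormedSpace ℝ (M i)]
      [∀ i, FiniteDimensional ℝ (M i)] (c : ℝ) (u : ⨂[ℝ] i, M i),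
      ν M (c • u) = |c| * ν M u) ∧
  (∀ (M : Fin l → Type) [∀ i, NormedAddCommGroup (M i)] [∀ i, NormedSpace ℝ (M i)]
      [∀ i, FiniteDimensional ℝ (M i)] (u : ⨂[ℝ] i, M i),
      ν M u = 0 → u = 0) ∧
  (∀ (M : Fin l → Type) [∀ i, NormedAddCommGroup (M i)] [∀ i, NormedSpace ℝ (M i)]
      [∀ i, FiniteDimensional ℝ (M i)] (u : ⨂[ℝ] i, M i),
      injNorm M u ≤ ν M u ∧ ν M u ≤ projNorm M u) ∧
  (∀ (M N : Fin l → Type) [∀ i, NormedAddCommGroup (M i)] [∀ i, NormedSpace ℝ (M i)]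
      [∀ i, FiniteDimensional ℝ (M i)] [∀ i, NormedAddCommGroup (N i)]
      [∀ i, NormedSpace ℝ (N i)] [∀ i, FiniteDimensional ℝ (N i)]
      (T : ∀ i, M i →L[ℝ] N i) (u : ⨂[ℝ] i, M i),
      ν N (PiTensorProduct.map (fun i => (T i : M i →ₗ[ℝ] N i)) u)
        ≤ (∏ i, ‖T i‖) * ν M u)

/-- `Corresponds A ν` : the tensor product of `0`-symmetric convex bodies `A` and the
tensor norm `ν` correspond to each other under Minkowski's bijection, i.e. for every
tuple of `0`-symmetric convex bodies `P i ⊆ E i` and every isometric model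
`e i : (M i, ‖·‖) ≃ (E i, g_{P i})` of the associated finite-dimensional Banach spaces,
`A E P` is the image of the closed unit ball of `ν` on `⨂ M i`. -/
def Corresponds (A : TPAssignment l) (ν : TNAssignment l) : Prop :=
  ∀ (E : Fin l → Type) [∀ i, NormedAddCommGroup (E i)] [∀ i, InnerProductSpace ℝ (E i)]
    [∀ i, FiniteDimensional ℝ (E i)]
    (M : Fin l → Type) [∀ i, NormedAddCommGroup (M i)] [∀ i, NormedSpace ℝ (M i)]
    [∀ i, FiniteDimensional ℝ (M i)]
    (P : ∀ i, Set (E i)), (∀ i, IsSymBody (P i)) →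
    ∀ (e : ∀ i, M i ≃ₗ[ℝ] E i), (∀ i (x : M i), ‖x‖ = gauge (P i) (e i x)) →
    A E P = PiTensorProduct.map (fun i => (e i : M i →ₗ[ℝ] E i)) '' {z | ν M z ≤ 1}

/-- A tensor norm is injective if the natural inclusions of subspace tensor products
are isometries. -/
def IsInjectiveTN (ν : TNAssignment l) : Prop :=
  ∀ (X : Fin l → Type) [∀ i, NormedAddCommGroup (X i)] [∀ i, NormedSpace ℝ (X i)]
    [∀ i, FiniteDimensional ℝ (X i)] (S : ∀ i, Submodule ℝ (X i)) (u : ⨂[ℝ] i, ↥(S i)),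
    ν (fun i => ↥(S i)) u = ν X (PiTensorProduct.map (fun i => (S i).subtype) u)

/-- A tensor norm is projective if tensor products of quotient operators (operators
mapping the open unit ball onto the open unit ball) are quotient operators. -/
def IsProjectiveTN (ν : TNAssignment l) : Prop :=
  ∀ (X Y : Fin l → Type) [∀ i, NormedAddCommGroup (X i)] [∀ i, NormedSpace ℝ (X i)]
    [∀ i, FiniteDimensional ℝ (X i)] [∀ i, NormedAddCommGroup (Y i)]
    [∀ i, NormedSpace ℝ (Y i)] [∀ i, FiniteDimensional ℝ (Y i)]
    (T : ∀ i, X i →L[ℝ] Y i),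
    (∀ i, (T i) '' Metric.ball 0 1 = Metric.ball 0 1) →
    {w : ⨂[ℝ] i, Y i | ν Y w < 1}
      = PiTensorProduct.map (fun i => (T i : X i →ₗ[ℝ] Y i)) '' {u | ν X u < 1}

/-- The canonical pairing between `⨂ (M i)*` and `⨂ M i`. -/
def dualPairing (M : Fin l → Type) [∀ i, NormedAddCommGroup (M i)]
    [∀ i, NormedSpace ℝ (M i)] :
    (⨂[ℝ] i, (M i →L[ℝ] ℝ)) →ₗ[ℝ] (⨂[ℝ] i, M i) →ₗ[ℝ] ℝ :=
  (PiTensorProduct.map₂ (fun i => ContinuousLinearMap.coeLM ℝ)).compr₂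
    (PiTensorProduct.lift (MultilinearMap.mkPiAlgebra ℝ (Fin l) ℝ))


/-- The projective tensor product `⊗_π` as an assignment. -/
def projA (l : ℕ) : TPAssignment l := fun E _ _ _ P => projTP E P

/-- The injective tensor product `⊗_ε` as an assignment. -/
def injA (l : ℕ) : TPAssignment l := fun E _ _ _ P => injTP E P

/-- The pointwise order on assignments of tensor norms. -/
def leTN (ν₁ ν₂ : TNAssignment l) : Prop :=
  ∀ (M : Fin l → Type) [∀ i, NormedAddCommGroup (M i)] [∀ i, NormedSpace ℝ (M i)]
    [∀ i, FiniteDimensional ℝ (M i)] (z : ⨂[ℝ] i, M i), ν₁ M z ≤ ν₂ M z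

/-- Pointwise equality of assignments of tensor norms. -/
def eqTN (ν₁ ν₂ : TNAssignment l) : Prop :=
  ∀ (M : Fin l → Type) [∀ i, NormedAddCommGroup (M i)] [∀ i, NormedSpace ℝ (M i)]
    [∀ i, FiniteDimensional ℝ (M i)] (z : ⨂[ℝ] i, M i), ν₁ M z = ν₂ M z

/-- Equality of two assignments on all tuples of `0`-symmetric convex bodies. -/
def eqOnSymBodies (A A' : TPAssignment l) : Prop :=
  ∀ (E : Fin l → Type) [∀ i, NormedAddCommGroup (E i)] [∀ i, InnerProductSpace ℝ (E i)]
    [∀ i, FiniteDimensional ℝ (E i)] (P : ∀ i, Set (E i)), (∀ i, IsSymBody (P i)) →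
    A E P = A' E P

/-- `ν'` is the dual tensor norm of `ν`:
`ν'(u) = sup {|φ(u)| : φ ∈ ⨂ᵢ Mᵢ*, ν_{M₁*,…,M_l*}(φ) ≤ 1}`. -/
def IsDualTN (ν ν' : TNAssignment l) : Prop :=
  ∀ (M : Fin l → Type) [∀ i, NormedAddCommGroup (M i)] [∀ i, NormedSpace ℝ (M i)]
    [∀ i, FiniteDimensional ℝ (M i)] (u : ⨂[ℝ] i, M i),
    ν' M u = sSup {r | ∃ φ : ⨂[ℝ] i, (M i →L[ℝ] ℝ),
      ν (fun i => M i →L[ℝ] ℝ) φ ≤ 1 ∧ r = |dualPairing M φ u|}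

/-- The image, under the continuous extension of `⨂ᵢ qᵢ` to the completed injective
tensor product `ℓ₁ ⊗̂_ε ⋯ ⊗̂_ε ℓ₁`, of the closed unit ball of that completion.
Since the closed unit ball of the completion is the closure of the closed unit ball of
the algebraic injective tensor product `(⨂ᵢ ℓ₁, ε)`, and since the extension is
continuous, this image is exactly the set of limits of images of `ε`-Cauchy sequences
from the algebraic `ε`-unit ball. -/
def completedEpsBallImage {l : ℕ} (E : Fin l → Type) [∀ i, NormedAddCommGroup (E i)]
    [∀ i, InnerProductSpace ℝ (E i)]
    (q : ∀ i, lp (fun _ : ℕ => ℝ) 1 →ₗ[ℝ] E i) : Set (⨂[ℝ] i, E i) :=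
  {y | ∃ u : ℕ → ⨂[ℝ] _i : Fin l, lp (fun _ : ℕ => ℝ) 1,
    (∀ n, injNorm (fun _ : Fin l => lp (fun _ : ℕ => ℝ) 1) (u n) ≤ 1) ∧
    (∀ δ : ℝ, 0 < δ → ∃ N, ∀ m ≥ N, ∀ n ≥ N,
      injNorm (fun _ : Fin l => lp (fun _ : ℕ => ℝ) 1) (u m - u n) < δ) ∧
    Filter.Tendsto (fun n => PiTensorProduct.map q (u n)) Filter.atTop (nhds y)}

end

/-- Membership in the injective tensor product can be tested on decomposable tensors. -/
theorem mem_injTP_iff {l : ℕ} (E : Fin l → Type) [∀ i, NormedAddCommGroup (E i)]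
    [∀ i, InnerProductSpace ℝ (E i)] (P : ∀ i, Set (E i)) (z : ⨂[ℝ] i, E i) :
    z ∈ injTP E P ↔ ∀ y : ∀ i, E i, (∀ i, y i ∈ polarB (innerₗ (E i)) (P i)) →
      tensorInner E (⨂ₜ[ℝ] i, y i) z ≤ 1 := by
  constructor
  · exact fun h y hy => h _ (subset_convexHull ℝ _ ⟨y, hy, rfl⟩)
  · intro h u hu
    have hsub : {u | ∃ x : ∀ i, E i, (∀ i, x i ∈ polarB (innerₗ (E i)) (P i)) ∧
        u = ⨂ₜ[ℝ] i, x i} ⊆ {u | (tensorInner E).flip z u ≤ 1} := by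
      rintro _ ⟨x, hx, rfl⟩
      exact h x hx
    exact convexHull_min hsub
      (convex_halfSpace_le ((tensorInner E).flip z).isLinear 1) hu

theorem tensorInner_tprod_tprod {l : ℕ} (E : Fin l → Type) [∀ i, NormedAddCommGroup (E i)]
    [∀ i, InnerProductSpace ℝ (E i)] (x y : ∀ i, E i) :
    tensorInner E (⨂ₜ[ℝ] i, x i) (⨂ₜ[ℝ] i, y i) = ∏ i, ⟪x i, y i⟫ := by
  simp [tensorInner, PiTensorProduct.map₂_tprod_tprod]

/-- If `x i` and `y i` induce the same functional on `M i`, then the decomposable tensors they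
form induce the same functional on `⨂ M i`. -/
theorem tensorInner_tprod_map_subtype {l : ℕ} (E : Fin l → Type)
    [∀ i, NormedAddCommGroup (E i)] [∀ i, InnerProductSpace ℝ (E i)]
    (M : ∀ i, Submodule ℝ (E i)) (x : ∀ i, E i) (y : ∀ i, M i)
    (h : ∀ i (m : M i), ⟪x i, (m : E i)⟫ = ⟪y i, m⟫) (w : ⨂[ℝ] i, M i) :
    tensorInner E (⨂ₜ[ℝ] i, x i) (PiTensorProduct.map (fun i => (M i).subtype) w)
      = tensorInner (fun i => M i) (⨂ₜ[ℝ] i, y i) w := by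
  suffices H : (tensorInner E (⨂ₜ[ℝ] i, x i)) ∘ₗ PiTensorProduct.map (fun i => (M i).subtype)
      = tensorInner (fun i => M i) (⨂ₜ[ℝ] i, y i) from LinearMap.congr_fun H w
  ext m
  simp only [LinearMap.compMultilinearMap_apply, LinearMap.comp_apply, map_tprod,
    tensorInner_tprod_tprod, Submodule.subtype_apply, h]

/-- The orthogonal projection onto `M` maps the polar of `P` into the polar of `P ∩ M`. -/
theorem orthogonalProjectionOnto_mem_polarB {E : Type*} [NormedAddCommGroup E]
    [InnerProductSpace ℝ E] (P : Set E) (M : Submodule ℝ E) [M.HasOrthogonalProjection]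
    {x : E} (hx : x ∈ polarB (innerₗ E) P) :
    M.orthogonalProjectionOnto x ∈ polarB (innerₗ M) (Subtype.val ⁻¹' P) := by
  intro u hu
  have := hx u hu
  rw [innerₗ_apply_apply] at this ⊢
  rwa [Submodule.inner_orthogonalProjectionOnto_eq_of_mem_left]

/-- Hahn–Banach: an element of the polar of `P ∩ M` in `M` induces the same functional on `M`
as some element of the polar of `P`. -/
theorem exists_mem_polarB_inner_eq {E : Type*} [NormedAddCommGroup E]
    [InnerProductSpace ℝ E] [FiniteDimensional ℝ E] {P : Set E} (hconv : Convex ℝ P)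
    (h0 : P ∈ nhds 0) (M : Submodule ℝ E) {y : M}
    (hy : y ∈ polarB (innerₗ M) (Subtype.val ⁻¹' P)) :
    ∃ x ∈ polarB (innerₗ E) P, ∀ m : M, ⟪x, (m : E)⟫ = ⟪y, m⟫ := by
  have habs : Absorbent ℝ P := absorbent_nhds_zero h0
  obtain ⟨g, hg, hgP⟩ := exists_extension_of_le_sublinear ⟨M, innerₗ M y⟩ (gauge P)
    (fun c hc => gauge_smul_of_nonneg hc.le) (gauge_add_le hconv habs) (by
      intro m
      refine le_of_forall_gt fun r hr => ?_
      obtain ⟨b, hb, hbr, p, hp, hpm⟩ := exists_lt_of_gauge_lt habs hr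
      have hm : b⁻¹ • (m : E) = p := by
        rw [← hpm]
        exact inv_smul_smul₀ hb.ne' p
      have hle := hy (b⁻¹ • m) (by simpa [hm] using hp)
      rw [innerₗ_apply_apply, real_inner_smul_left, real_inner_comm, inv_mul_le_one₀ hb] at hle
      exact hle.trans_lt hbr)
  have hxg : ∀ v, ⟪(InnerProductSpace.toDual ℝ E).symm g.toContinuousLinearMap, v⟫ = g v :=
    fun v => by simp
  refine ⟨(InnerProductSpace.toDual ℝ E).symm g.toContinuousLinearMap, fun u hu => ?_,
    fun m => (hxg m).trans (hg m)⟩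
  rw [innerₗ_apply_apply, real_inner_comm, hxg]
  exact (hgP u).trans (gauge_le_one_of_mem hu)

/-- **The injective tensor product of convex bodies respects sections.** For subspaces
`M i ⊆ E i` (with the induced inner products),
`(P₁ ∩ M₁) ⊗_ε ⋯ ⊗_ε (P_l ∩ M_l) = (P₁ ⊗_ε ⋯ ⊗_ε P_l) ∩ ⨂ᵢ M i`, where the left-hand
side, computed inside `⨂ᵢ M i`, is compared with the right-hand side via the canonical
embedding `⨂ᵢ M i → ⨂ᵢ E i`. -/
theorem injTP_respects_sections {l : ℕ}
    (E : Fin l → Type) [∀ i, NormedAddCommGroup (E i)] [∀ i, InnerProductSpace ℝ (E i)]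
    [∀ i, FiniteDimensional ℝ (E i)]
    (P : ∀ i, Set (E i)) (hP : ∀ i, IsZeroBody (P i))
    (M : ∀ i, Submodule ℝ (E i)) :
    PiTensorProduct.map (fun i => (M i).subtype) ''
        injTP (fun i => ↥(M i)) (fun i => Subtype.val ⁻¹' P i)
      = injTP E P ∩ Set.range (PiTensorProduct.map (fun i => (M i).subtype)) := by
  ext z
  simp only [Set.mem_image, Set.mem_inter_iff, Set.mem_range]
  have key : ∀ w : ⨂[ℝ] i, M i, w ∈ injTP (fun i => ↥(M i)) (fun i => Subtype.val ⁻¹' P i) ↔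
      PiTensorProduct.map (fun i => (M i).subtype) w ∈ injTP E P := by
    intro w
    rw [mem_injTP_iff, mem_injTP_iff]
    constructor
    · intro h x hx
      rw [tensorInner_tprod_map_subtype E M x (fun i => (M i).orthogonalProjectionOnto (x i))
        (fun i m => ((M i).inner_orthogonalProjectionOnto_eq_of_mem_right m (x i)).symm)]
      exact h _ fun i => orthogonalProjectionOnto_mem_polarB (P i) (M i) (hx i)
    · intro h y hy
      choose x hx hxy using fun i => exists_mem_polarB_inner_eq (hP i).2.1
        (mem_interior_iff_mem_nhds.mp (hP i).2.2) (M i) (hy i)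
      rw [← tensorInner_tprod_map_subtype E M x y hxy]
      exact h x hx
  constructor
  · rintro ⟨w, hw, rfl⟩
    exact ⟨(key w).mp hw, w, rfl⟩
  · rintro ⟨hz, w, rfl⟩
    exact ⟨w, (key w).mpr hz, rfl⟩
end

section
/- A tensor norm induces a tensor product of 0-symmetric convex bodies: Let α be a tensor norm of order l on finite-dimensional Banach spaces. For every l-tuple of 0-symmetric convex bodies P_i ⊆ E_i in finite-dimensional real inner product spaces, define P_1⊗_α⋯⊗_αP_l to be the closed unit ball of the norm α on ⊗_{i=1}^l (E_i, g_{P_i}), where g_{P_i} is the Minkowski functional of P_i. Then this assignment is a tensor product of 0-symmetric convex bodies of order l. -/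
open scoped TensorProduct RealInnerProductSpace Pointwise
open PiTensorProduct

noncomputable section

variable {l : ℕ}

/-! ### Norms given by functions -/

/-- A function satisfying the norm axioms defines a normed space structure. -/
lemma normedSpaceCore_of_norm {V : Type*} [AddCommGroup V] [Module ℝ V] (n : V → ℝ)
    (hadd : ∀ x y, n (x + y) ≤ n x + n y) (hsmul : ∀ (c : ℝ) x, n (c • x) = |c| * n x)
    (hzero : ∀ x, n x = 0 → x = 0) : @NormedSpace.Core ℝ V _ _ _ ⟨n⟩ := by
  have h0 : n 0 = 0 := by simpa using hsmul 0 0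
  have hneg : ∀ x, n (-x) = n x := fun x => by simpa using hsmul (-1) x
  let : Norm V := ⟨n⟩
  exact
    { norm_nonneg := fun x => by
        change 0 ≤ n x
        have h := hadd x (-x)
        rw [add_neg_cancel, h0, hneg] at h
        linarith
      norm_smul := hsmul
      norm_triangle := hadd
      norm_eq_zero_iff := fun x => ⟨hzero x, fun h => h ▸ h0⟩ }

/-- A function satisfying the norm axioms is the norm of an isomorphic normed space. -/
lemma exists_normed_model_of_norm {V : Type} [AddCommGroup V] [Module ℝ V]
    [FiniteDimensional ℝ V] (n : V → ℝ)
    (hadd : ∀ x y, n (x + y) ≤ n x + n y) (hsmul : ∀ (c : ℝ) x, n (c • x) = |c| * n x)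
    (hzero : ∀ x, n x = 0 → x = 0) :
    ∃ (M : Type) (_ : NormedAddCommGroup M) (_ : NormedSpace ℝ M)
      (_ : FiniteDimensional ℝ M) (e : M ≃ₗ[ℝ] V), ∀ x, ‖x‖ = n (e x) := by
  have core := normedSpaceCore_of_norm n hadd hsmul hzero
  let : Norm V := ⟨n⟩
  exact ⟨V, NormedAddCommGroup.ofCore core,
    @NormedSpace.ofCore ℝ V _ (SeminormedAddCommGroup.ofCore core.toCore) _ core,
    inferInstanceAs (FiniteDimensional ℝ V), LinearEquiv.refl ℝ V, fun _ => rfl⟩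

/-! ### Gauges of symmetric bodies -/

lemma IsSymBody.mem_nhds_zero {V : Type*} [NormedAddCommGroup V] [NormedSpace ℝ V] {P : Set V}
    (hP : IsSymBody P) : P ∈ nhds (0 : V) := by
  obtain ⟨⟨-, hconv, x, hx⟩, hsymm⟩ := hP
  have hneg : -x ∈ interior P := by
    rw [hsymm, ← Set.image_neg_eq_neg, ← Homeomorph.coe_neg, ← Homeomorph.image_interior]
    exact ⟨x, hx, rfl⟩
  have h0 := hconv.interior hx hneg (by norm_num : (0 : ℝ) ≤ 1 / 2)
    (by norm_num : (0 : ℝ) ≤ 1 / 2) (by norm_num)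
  rw [smul_neg, add_neg_cancel] at h0
  exact mem_interior_iff_mem_nhds.1 h0

lemma IsSymBody.neg_mem {V : Type*} [AddCommGroup V] [Module ℝ V] [TopologicalSpace V]
    {P : Set V} (hP : IsSymBody P) {x : V} (hx : x ∈ P) : -x ∈ P := by
  rw [hP.2] at hx
  exact hx

/-- A linear map carrying `P` into `Q` does not increase gauges. -/
lemma gauge_map_le {V W : Type*} [AddCommGroup V] [Module ℝ V] [AddCommGroup W] [Module ℝ W]
    {P : Set V} {Q : Set W} (hP : Absorbent ℝ P) (T : V →ₗ[ℝ] W) (hT : ∀ x ∈ P, T x ∈ Q)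
    (x : V) : gauge Q (T x) ≤ gauge P x := by
  have h : gauge Q (T x) = gauge (T ⁻¹' Q) x := by
    simp only [gauge_def', Set.mem_preimage, map_smul]
  rw [h]
  exact gauge_mono hP hT x

/-- A linear functional bounded by `1` on `P` is dominated by the gauge of `P`. -/
lemma abs_apply_le_gauge {V : Type*} [AddCommGroup V] [Module ℝ V] {P : Set V}
    (hP : Absorbent ℝ P) (f : V →ₗ[ℝ] ℝ) (hf : ∀ x ∈ P, |f x| ≤ 1) (x : V) :
    |f x| ≤ gauge P x := by
  have h := gauge_map_le (Q := Metric.closedBall (0 : ℝ) 1) hP f (by simpa using hf) x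
  rwa [gauge_closedBall zero_le_one, div_one, Real.norm_eq_abs] at h

/-- A symmetric body is the unit ball of a finite-dimensional normed space. -/
lemma exists_normed_model {V : Type} [NormedAddCommGroup V] [NormedSpace ℝ V]
    [FiniteDimensional ℝ V] {P : Set V} (hP : IsSymBody P) :
    ∃ (M : Type) (_ : NormedAddCommGroup M) (_ : NormedSpace ℝ M)
      (_ : FiniteDimensional ℝ M) (e : M ≃ₗ[ℝ] V), ∀ x, ‖x‖ = gauge P (e x) := by
  have habs : Absorbent ℝ P := absorbent_nhds_zero hP.mem_nhds_zero
  have hbdd : Bornology.IsVonNBounded ℝ P := hP.1.1.isVonNBounded ℝ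
  refine exists_normed_model_of_norm (gauge P) (gauge_add_le hP.1.2.1 habs) (fun c x => ?_)
    fun x => (gauge_eq_zero habs hbdd).1
  rcases abs_cases c with ⟨h, hc⟩ | ⟨h, hc⟩
  · rw [h, gauge_smul_of_nonneg hc, smul_eq_mul]
  · rw [h, ← gauge_neg (fun y hy => hP.neg_mem hy), ← neg_smul,
      gauge_smul_of_nonneg (by linarith), smul_eq_mul]

/-! ### The unit ball of a norm in the weak topology of all linear functionals -/

/-- On a finite-dimensional normed space the norm topology is the weak topology induced by all
linear functionals. -/
lemma normTopology_eq_iInf_induced {V : Type*} [NormedAddCommGroup V] [NormedSpace ℝ V]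
    [FiniteDimensional ℝ V] :
    (inferInstance : TopologicalSpace V) =
      ⨅ f : V →ₗ[ℝ] ℝ, TopologicalSpace.induced f inferInstance := by
  apply le_antisymm
  · exact le_iInf fun f => (f.continuous_of_finiteDimensional).le_induced
  · let b := Module.finBasis ℝ V
    have hb : (inferInstance : TopologicalSpace V) =
        TopologicalSpace.induced b.equivFun inferInstance :=
      b.equivFunL.toHomeomorph.isInducing.eq_induced
    simp only [hb, Pi.topologicalSpace, induced_iInf, induced_compose]
    exact le_iInf fun i => iInf_le (fun f : V →ₗ[ℝ] ℝ => TopologicalSpace.induced f inferInstance) (b.coord i)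

/-- The closed unit ball of a norm on a finite-dimensional space is a symmetric body for the weak
topology induced by all linear functionals. -/
lemma isSymBody_unitBall {V : Type*} [AddCommGroup V] [Module ℝ V] [FiniteDimensional ℝ V]
    (t : TopologicalSpace V)
    (ht : t = ⨅ f : V →ₗ[ℝ] ℝ, TopologicalSpace.induced f inferInstance) (n : V → ℝ)
    (hadd : ∀ x y, n (x + y) ≤ n x + n y) (hsmul : ∀ (c : ℝ) x, n (c • x) = |c| * n x)
    (hzero : ∀ x, n x = 0 → x = 0) : IsSymBody {x | n x ≤ 1} := by
  have hneg : ∀ x, n (-x) = n x := fun x => by simpa using hsmul (-1) x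
  have core := normedSpaceCore_of_norm n hadd hsmul hzero
  let : NormedAddCommGroup V := @NormedAddCommGroup.ofCore ℝ V _ _ _ ⟨n⟩ core
  let : NormedSpace ℝ V :=
    @NormedSpace.ofCore ℝ V _ (@SeminormedAddCommGroup.ofCore ℝ V _ _ ⟨n⟩ _ core.toCore) _ core
  have hball : {x | n x ≤ 1} = Metric.closedBall (0 : V) 1 := by
    ext x
    rw [mem_closedBall_zero_iff]
    rfl
  obtain rfl := ht.trans (normTopology_eq_iInf_induced (V := V)).symm
  have : ProperSpace V := FiniteDimensional.proper ℝ V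
  refine ⟨⟨?_, ?_, 0, ?_⟩, ?_⟩
  · rw [hball]; exact isCompact_closedBall _ _
  · rw [hball]; exact convex_closedBall _ _
  · rw [hball]; exact mem_interior_iff_mem_nhds.2 (Metric.closedBall_mem_nhds _ one_pos)
  · ext x
    simp [hneg]

/-! ### Projective and injective norms on decomposable tensors -/

lemma projNorm_tprod_le {l : ℕ} (M : Fin l → Type) [∀ i, NormedAddCommGroup (M i)]
    [∀ i, NormedSpace ℝ (M i)] (x : ∀ i, M i) :
    projNorm M (⨂ₜ[ℝ] i, x i) ≤ ∏ i, ‖x i‖ := by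
  refine csInf_le ⟨0, ?_⟩ ⟨1, fun _ => x, by simp, by simp⟩
  rintro _ ⟨n, y, -, rfl⟩
  positivity

lemma le_injNorm {l : ℕ} (M : Fin l → Type) [∀ i, NormedAddCommGroup (M i)]
    [∀ i, NormedSpace ℝ (M i)] (u : ⨂[ℝ] i, M i) (f : ∀ i, M i →L[ℝ] ℝ)
    (hf : ∀ i, ‖f i‖ ≤ 1) :
    |PiTensorProduct.lift ((MultilinearMap.mkPiAlgebra ℝ (Fin l) ℝ).compLinearMap
      (fun i => (f i : M i →ₗ[ℝ] ℝ))) u| ≤ injNorm M u := by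
  refine le_csSup ?_ ⟨f, hf, rfl⟩
  obtain ⟨C, hC⟩ : ∃ C : ℝ, ∀ f : ∀ i, M i →L[ℝ] ℝ, (∀ i, ‖f i‖ ≤ 1) →
      |PiTensorProduct.lift ((MultilinearMap.mkPiAlgebra ℝ (Fin l) ℝ).compLinearMap
        (fun i => (f i : M i →ₗ[ℝ] ℝ))) u| ≤ C := by
    induction u using PiTensorProduct.induction_on with
    | smul_tprod r x =>
      refine ⟨|r| * ∏ i, ‖x i‖, fun f hf => ?_⟩
      simp only [map_smul, smul_eq_mul, abs_mul, lift.tprod, MultilinearMap.compLinearMap_apply,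
        MultilinearMap.mkPiAlgebra_apply, Finset.abs_prod]
      gcongr with i
      exact (f i).le_of_opNorm_le_of_le (hf i) le_rfl |>.trans (one_mul _).le
    | add u v hu hv =>
      obtain ⟨C, hC⟩ := hu
      obtain ⟨D, hD⟩ := hv
      refine ⟨C + D, fun f hf => ?_⟩
      rw [map_add]
      exact (abs_add_le _ _).trans (add_le_add (hC f hf) (hD f hf))
  refine ⟨C, ?_⟩
  rintro _ ⟨f, hf, rfl⟩
  exact hC f hf

/-- Pairing with a decomposable tensor in the Hilbert tensor product. -/
lemma tensorInner_tprod {l : ℕ} (E : Fin l → Type) [∀ i, NormedAddCommGroup (E i)]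
    [∀ i, InnerProductSpace ℝ (E i)] (y : ∀ i, E i) :
    tensorInner E (⨂ₜ[ℝ] i, y i) =
      PiTensorProduct.lift ((MultilinearMap.mkPiAlgebra ℝ (Fin l) ℝ).compLinearMap
        (fun i => innerₗ (E i) (y i))) := by
  ext z
  simp [tensorInner, PiTensorProduct.map₂_tprod_tprod]

/-! ### The tensor product of symmetric bodies induced by a tensor norm -/

/-- The unit ball of `ν`, transported from all isometric models of the spaces `(E i, g_{P i})`. -/
def unitBallTP {l : ℕ} (ν : TNAssignment l) : TPAssignment l := fun E _ _ _ P =>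
  {z | ∃ (M : Fin l → Type) (_ : ∀ i, NormedAddCommGroup (M i))
    (_ : ∀ i, NormedSpace ℝ (M i)) (_ : ∀ i, FiniteDimensional ℝ (M i))
    (e : ∀ i, M i ≃ₗ[ℝ] E i), (∀ i (x : M i), ‖x‖ = gauge (P i) (e i x)) ∧
    ∃ w, ν M w ≤ 1 ∧ PiTensorProduct.map (fun i => (e i : M i →ₗ[ℝ] E i)) w = z}

/-- Maps between bodies induce maps between the unit balls of their models. -/
lemma map_image_unitBall_subset {l : ℕ} {ν : TNAssignment l} (hν : IsTensorNormFD ν)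
    {E F : Fin l → Type} [∀ i, NormedAddCommGroup (E i)] [∀ i, InnerProductSpace ℝ (E i)]
    [∀ i, NormedAddCommGroup (F i)] [∀ i, InnerProductSpace ℝ (F i)]
    {M N : Fin l → Type} [∀ i, NormedAddCommGroup (M i)] [∀ i, NormedSpace ℝ (M i)]
    [∀ i, FiniteDimensional ℝ (M i)] [∀ i, NormedAddCommGroup (N i)]
    [∀ i, NormedSpace ℝ (N i)] [∀ i, FiniteDimensional ℝ (N i)]
    {P : ∀ i, Set (E i)} {Q : ∀ i, Set (F i)} (hP : ∀ i, IsSymBody (P i))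
    (e : ∀ i, M i ≃ₗ[ℝ] E i) (he : ∀ i (x : M i), ‖x‖ = gauge (P i) (e i x))
    (f : ∀ i, N i ≃ₗ[ℝ] F i) (hf : ∀ i (x : N i), ‖x‖ = gauge (Q i) (f i x))
    (T : ∀ i, E i →ₗ[ℝ] F i) (hT : ∀ i, T i '' P i ⊆ Q i) {w : ⨂[ℝ] i, M i} (hw : ν M w ≤ 1) :
    ∃ w', ν N w' ≤ 1 ∧ PiTensorProduct.map (fun i => (f i : N i →ₗ[ℝ] F i)) w' =
      PiTensorProduct.map T (PiTensorProduct.map (fun i => (e i : M i →ₗ[ℝ] E i)) w) := by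
  let S : ∀ i, M i →L[ℝ] N i := fun i =>
    LinearMap.toContinuousLinearMap ((f i).symm.toLinearMap ∘ₗ T i ∘ₗ (e i).toLinearMap)
  have hS : ∀ i, ‖S i‖ ≤ 1 := fun i => by
    refine (S i).opNorm_le_bound zero_le_one fun x => ?_
    rw [one_mul, hf, he]
    have := gauge_map_le (absorbent_nhds_zero (hP i).mem_nhds_zero) (T i)
      (fun y hy => hT i ⟨y, hy, rfl⟩) (e i x)
    simpa [S] using this
  have hprod : ∏ i, ‖S i‖ ≤ 1 := Finset.prod_le_one (fun i _ => norm_nonneg _) fun i _ => hS i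
  refine ⟨PiTensorProduct.map (fun i => (S i : M i →ₗ[ℝ] N i)) w, ?_, ?_⟩
  · refine (hν.2.2.2.2 M N S w).trans ?_
    have hprod0 : 0 ≤ ∏ i, ‖S i‖ := by positivity
    nlinarith
  · simp only [← LinearMap.comp_apply, ← PiTensorProduct.map_comp]
    congr 2
    ext i x
    simp [S]

lemma unitBallTP_corresponds {l : ℕ} {ν : TNAssignment l} (hν : IsTensorNormFD ν) :
    Corresponds (unitBallTP ν) ν := by
  intro E _ _ _ M _ _ _ P hP e he
  ext z
  constructor
  · rintro ⟨N, _, _, _, f, hf, w, hw, rfl⟩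
    obtain ⟨w', hw', h⟩ := map_image_unitBall_subset hν hP f hf e he
      (fun i => LinearMap.id) (fun i => by simp) hw
    exact ⟨w', hw', by rw [h, PiTensorProduct.map_id, LinearMap.id_apply]⟩
  · rintro ⟨w, hw, rfl⟩
    exact ⟨M, _, _, _, e, he, w, hw, rfl⟩

lemma unitBallTP_isTPSym {l : ℕ} {ν : TNAssignment l} (hν : IsTensorNormFD ν) :
    IsTPSym (unitBallTP ν) := by
  refine ⟨?_, ?_⟩
  · intro E _ _ _ P hP
    choose M i₁ i₂ i₃ e he using fun i => exists_normed_model (hP i)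
    have hA := unitBallTP_corresponds hν E M P hP e he
    have habs : ∀ i, Absorbent ℝ (P i) := fun i => absorbent_nhds_zero (hP i).mem_nhds_zero
    rw [hA]
    have hbody : IsSymBody (PiTensorProduct.map (fun i => (e i : M i →ₗ[ℝ] E i)) ''
        {z | ν M z ≤ 1}) := by
      have hset : PiTensorProduct.map (fun i => (e i : M i →ₗ[ℝ] E i)) '' {z | ν M z ≤ 1} =
          {z | ν M ((PiTensorProduct.congr e).symm z) ≤ 1} :=
        (PiTensorProduct.congr e).toEquiv.image_eq_preimage_symm _
      rw [hset]
      refine isSymBody_unitBall _ rfl _ (fun x y => ?_) (fun c x => ?_) (fun x hx => ?_)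
      · rw [map_add]; exact hν.1 M _ _
      · rw [map_smul]; exact hν.2.1 M _ _
      · simpa using hν.2.2.1 M _ hx
    refine ⟨hbody, ?_, ?_⟩
    · refine convexHull_min ?_ hbody.1.2.1
      rintro _ ⟨x, hx, rfl⟩
      refine ⟨⨂ₜ[ℝ] i, (e i).symm (x i), ?_, by simp⟩
      refine (hν.2.2.2.1 M _).2.trans ((projNorm_tprod_le M _).trans ?_)
      refine Finset.prod_le_one (fun i _ => norm_nonneg _) fun i _ => ?_
      rw [he, LinearEquiv.apply_symm_apply]
      exact gauge_le_one_of_mem (hx i)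
    · rintro _ ⟨w, hw, rfl⟩ u hu
      have hconv : Convex ℝ {u | tensorInner E u
          (PiTensorProduct.map (fun i => (e i : M i →ₗ[ℝ] E i)) w) ≤ 1} :=
        convex_halfSpace_le (((tensorInner E).flip _).isLinear) 1
      refine convexHull_min ?_ hconv hu
      rintro _ ⟨y, hy, rfl⟩
      let f : ∀ i, M i →L[ℝ] ℝ := fun i =>
        LinearMap.toContinuousLinearMap (innerₗ (E i) (y i) ∘ₗ (e i).toLinearMap)
      have hf : ∀ i, ‖f i‖ ≤ 1 := fun i => by
        refine (f i).opNorm_le_bound zero_le_one fun x => ?_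
        rw [one_mul, he]
        refine abs_apply_le_gauge (habs i) (innerₗ (E i) (y i)) (fun p hp => ?_) (e i x)
        have h1 := hy i p hp
        have h2 := hy i (-p) ((hP i).neg_mem hp)
        simp only [innerₗ_apply_apply, inner_neg_left] at h1 h2 ⊢
        rw [real_inner_comm]
        exact abs_le.2 ⟨by linarith, h1⟩
      have key := (le_abs_self _).trans ((le_injNorm M w f hf).trans
        ((hν.2.2.2.1 M w).1.trans hw))
      refine le_trans (le_of_eq ?_) key
      rw [tensorInner_tprod, ← LinearMap.comp_apply, PiTensorProduct.lift_comp_map]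
      rfl
  · rintro E F _ _ _ _ _ _ P Q T hP hQ hT _ ⟨_, ⟨M, _, _, _, e, he, w, hw, rfl⟩, rfl⟩
    choose N i₁ i₂ i₃ f hf using fun i => exists_normed_model (hQ i)
    obtain ⟨w', hw', h⟩ := map_image_unitBall_subset hν hP e he f hf T hT hw
    exact ⟨N, i₁, i₂, i₃, f, hf, w', hw', h⟩

/-- **A tensor norm induces a tensor product of `0`-symmetric convex bodies.** For a
tensor norm `α` on finite-dimensional Banach spaces, the assignment sending
`0`-symmetric convex bodies `P i ⊆ E i` to the closed unit ball of `α` on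
`⨂ᵢ (E i, g_{P i})` is a tensor product of `0`-symmetric convex bodies. -/
theorem TPSym_of_tensorNorm {l : ℕ} (ν : TNAssignment l) (hν : IsTensorNormFD ν) :
    ∃ A : TPAssignment l, IsTPSym A ∧ Corresponds A ν :=
  ⟨unitBallTP ν, unitBallTP_isTPSym hν, unitBallTP_corresponds hν⟩
end
end
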